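/- arXiv:2512.10590 — 2 statements merged into one kernel-verified Lean document; each statement's English description precedes it below -/
import Mathlib

section
/- Let G be a connected finite simple graph and let T be a set of edges of G, each of which is a bridge (cut-edge) of G. If for every connected component C of the graph obtained from G by deleting all edges of T, the induced subgraph of G on the vertex set of C has property (P), then G has property (P). -/
open Matrix SimpleGraph

/-- A finite simple graph `G` has property (P) if there is a real symmetric matrix `A`
whose off-diagonal support is exactly the edge set of `G`, with `det A ≠ 0`, and such that
every principal submatrix obtained by deleting one row/column is singular. -/
def HasPropertyP {V : Type*} [Finite V] (G : SimpleGraph V) : Prop :=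
  letI : Fintype V := Fintype.ofFinite V
  letI : DecidableEq V := Classical.decEq V
  ∃ A : Matrix V V ℝ, A.IsSymm ∧
    (∀ u v : V, u ≠ v → (A u v ≠ 0 ↔ G.Adj u v)) ∧
    A.det ≠ 0 ∧
    ∀ v : V,
      (A.submatrix (fun x : {x : V // x ≠ v} => (x : V))
        (fun x : {x : V // x ≠ v} => (x : V))).det = 0


theorem adj_diag_aux {V : Type*} [Fintype V] [DecidableEq V] (A : Matrix V V ℝ) (v : V) :
    A.adjugate v v = (A.submatrix (fun x : {x : V // x ≠ v} => (x : V))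
        (fun x : {x : V // x ≠ v} => (x : V))).det := by
  rw [Matrix.adjugate_apply]
  rw [Matrix.twoBlockTriangular_det' _ (fun x => x = v)]
  · have h1 : Matrix.toSquareBlockProp (A.updateRow v (Pi.single v 1)) (fun x => x = v) = 1 := by
      ext ⟨i, hi⟩ ⟨j, hj⟩
      subst hi
      subst hj
      simp [Matrix.toSquareBlockProp]
    have h2 : ∀ (F : Fintype {x // x = v}),
        (Matrix.toSquareBlockProp (A.updateRow v (Pi.single v 1)) (fun x => x = v)).det = 1 := by
      intro F
      rw [h1, Matrix.det_one]
    rw [h2 _, one_mul]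
    congr 1
    ext ⟨i, hi⟩ ⟨j, hj⟩
    simp [Matrix.toSquareBlockProp, Matrix.updateRow_ne hi]
  · intro i hi j hj
    subst hi
    simp [Pi.single_eq_of_ne hj]

theorem hasP_iff {V : Type*} [Finite V] [i1 : Fintype V] [i2 : DecidableEq V] (G : SimpleGraph V) :
    HasPropertyP G ↔ ∃ A B : Matrix V V ℝ, A.IsSymm ∧
      (∀ u v : V, u ≠ v → (A u v ≠ 0 ↔ G.Adj u v)) ∧ A * B = 1 ∧ ∀ v, B v v = 0 := by
  have e1 : i1 = Fintype.ofFinite V := Subsingleton.elim _ _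
  have e2 : i2 = Classical.decEq V := Subsingleton.elim _ _
  subst e1
  subst e2
  letI : Fintype V := Fintype.ofFinite V
  letI : DecidableEq V := Classical.decEq V
  unfold HasPropertyP
  constructor
  · rintro ⟨A, hs, ha, hd, hv⟩
    refine ⟨A, A⁻¹, hs, ha, Matrix.mul_nonsing_inv A (isUnit_iff_ne_zero.mpr hd), fun v => ?_⟩
    rw [Matrix.inv_def, Matrix.smul_apply, adj_diag_aux, hv v, smul_zero]
  · rintro ⟨A, B, hs, ha, hAB, hB⟩
    have hd : A.det ≠ 0 := by
      intro h
      have := congrArg Matrix.det hAB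
      rw [Matrix.det_mul, h, zero_mul, Matrix.det_one] at this
      exact zero_ne_one this
    refine ⟨A, hs, ha, hd, fun v => ?_⟩
    have hinv : A⁻¹ = B := Matrix.inv_eq_right_inv hAB
    have h := hB v
    rw [← hinv, Matrix.inv_def, Matrix.smul_apply, adj_diag_aux, smul_eq_mul] at h
    refine (mul_eq_zero.mp h).resolve_left ?_
    rw [Ring.inverse_eq_inv']
    exact inv_ne_zero hd

theorem inv_cross_zero {V : Type*} [Fintype V] [DecidableEq V] (A B : Matrix V V ℝ)
    (hAB : A * B = 1) (S : Set V) (hA : ∀ x y, ¬ (x ∈ S ↔ y ∈ S) → A x y = 0)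
    (x y : V) (hxy : ¬ (x ∈ S ↔ y ∈ S)) : B x y = 0 := by
  classical
  have hBA : B * A = 1 := mul_eq_one_comm.mp hAB
  let D : Matrix V V ℝ := Matrix.diagonal (fun x => if x ∈ S then 1 else 0)
  have hc : A * D = D * A := by
    ext i j
    simp only [D, Matrix.mul_diagonal, Matrix.diagonal_mul]
    by_cases h : (i ∈ S ↔ j ∈ S)
    · simp [h]
    · simp [hA i j h]
  have hc2 : D * B = B * D := by
    calc D * B = (B * A) * D * B := by rw [hBA, one_mul]
      _ = B * (A * D) * B := by simp only [Matrix.mul_assoc]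
      _ = B * D * (A * B) := by rw [hc]; simp only [Matrix.mul_assoc]
      _ = B * D := by rw [hAB, mul_one]
  have h := congrFun (congrFun hc2 x) y
  simp only [D, Matrix.mul_diagonal, Matrix.diagonal_mul] at h
  by_cases hx : x ∈ S <;> by_cases hy : y ∈ S <;> simp_all

theorem add_bridge {V : Type*} [Finite V] (H K : SimpleGraph V) (u v : V)
    (hr : ¬ H.Reachable u v)
    (hH : ∀ x y, K.Adj x y ↔ H.Adj x y ∨ (x = u ∧ y = v) ∨ (x = v ∧ y = u))
    (hP : HasPropertyP H) : HasPropertyP K := by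
  classical
  letI : Fintype V := Fintype.ofFinite V
  rw [hasP_iff] at hP ⊢
  obtain ⟨A, B, hs, ha, hAB, hB⟩ := hP
  have huv : u ≠ v := by
    rintro rfl
    exact hr (SimpleGraph.Reachable.refl _)
  let S : Set V := {w | H.Reachable u w}
  have huS : u ∈ S := SimpleGraph.Reachable.refl _
  have hvS : v ∉ S := hr
  have hAS : ∀ x y, ¬ (x ∈ S ↔ y ∈ S) → A x y = 0 := by
    intro x y hxy
    by_contra h
    have hne : x ≠ y := by
      rintro rfl
      exact hxy Iff.rfl
    have hadj := (ha x y hne).mp h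
    exact hxy ⟨fun hx => hx.trans hadj.reachable, fun hy => hy.trans hadj.symm.reachable⟩
  have hBS := inv_cross_zero A B hAB S hAS
  have hBuv : B u v = 0 := hBS u v (by simp [huS, hvS])
  have hBvu : B v u = 0 := hBS v u (by simp [huS, hvS])
  let E : Matrix V V ℝ := Matrix.single u v 1 + Matrix.single v u 1
  have hEBE : E * B * E = 0 := by
    simp only [E, add_mul, mul_add, Matrix.single_mul_mul_single, hB u, hB v, hBuv, hBvu]
    simp
  refine ⟨A + E, B - B * E * B, ?_, ?_, ?_, ?_⟩
  · unfold Matrix.IsSymm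
    rw [Matrix.transpose_add, hs.eq]
    simp only [E, Matrix.transpose_add, Matrix.transpose_single]
    rw [add_comm (Matrix.single v u (1:ℝ))]
  · intro x y hxy
    rw [hH]
    have hAuv : A u v = 0 := hAS u v (by simp [huS, hvS])
    have hAvu : A v u = 0 := hAS v u (by simp [huS, hvS])
    rw [← ha x y hxy]
    simp only [E, Matrix.add_apply, Matrix.single_apply]
    by_cases h1 : x = u ∧ y = v
    · obtain ⟨rfl, rfl⟩ := h1
      simp [hAuv, huv, huv.symm]
    · by_cases h2 : x = v ∧ y = u
      · obtain ⟨rfl, rfl⟩ := h2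
        simp [hAvu, huv, huv.symm]
      · have hn1 : ¬ (u = x ∧ v = y) := fun h => h1 ⟨h.1.symm, h.2.symm⟩
        have hn2 : ¬ (v = x ∧ u = y) := fun h => h2 ⟨h.1.symm, h.2.symm⟩
        simp [h1, h2, hn1, hn2]
  · have : (A + E) * (B - B * E * B) = A * B - (A * B) * E * B + E * B - (E * B * E) * B := by
      noncomm_ring
    rw [this, hAB, hEBE]
    simp
  · intro w
    have h : (B * E * B) w w = B w u * B v w + B w v * B u w := by
      simp [E, mul_add, add_mul, Matrix.mul_apply, Matrix.single_apply, ite_and, Finset.sum_add_distrib]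
    rw [Matrix.sub_apply, hB w, h]
    by_cases hw : w ∈ S
    · rw [hBS v w (by simp [hw, hvS]), hBS w v (by simp [hw, hvS])]
      simp
    · rw [hBS u w (by simp [hw, huS]), hBS w u (by simp [hw, huS])]
      simp

theorem base_case {V : Type*} [Finite V] (G : SimpleGraph V)
    (T : Set (Sym2 V)) (hT : ∀ e ∈ T, G.IsBridge e)
    (hcomp : ∀ C : (G.deleteEdges T).ConnectedComponent,
      HasPropertyP (G.induce C.supp)) :
    HasPropertyP (G.deleteEdges T) := by
  classical
  letI : Fintype V := Fintype.ofFinite V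
  letI : Fintype (G.deleteEdges T).ConnectedComponent := Fintype.ofFinite _
  simp only [hasP_iff] at hcomp
  rw [hasP_iff]
  choose A B hs ha hAB hB using hcomp
  let e : V ≃ (Σ C : (G.deleteEdges T).ConnectedComponent, C.supp) :=
    (Equiv.sigmaFiberEquiv (G.deleteEdges T).connectedComponentMk).symm
  have he : ∀ x, e x = ⟨(G.deleteEdges T).connectedComponentMk x, ⟨x, rfl⟩⟩ := fun x => rfl
  have hesymm : ∀ p, e.symm p = p.2.1 := fun p => rfl
  refine ⟨(Matrix.blockDiagonal' A).submatrix e e, (Matrix.blockDiagonal' B).submatrix e e,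
    ?_, ?_, ?_, ?_⟩
  · unfold Matrix.IsSymm
    rw [Matrix.transpose_submatrix, Matrix.blockDiagonal'_transpose]
    congr 2
    funext k
    exact (hs k).eq
  · intro x y hxy
    obtain ⟨⟨C, x⟩, rfl⟩ := e.symm.surjective x
    obtain ⟨⟨C2, y⟩, rfl⟩ := e.symm.surjective y
    simp only [Matrix.submatrix_apply, Equiv.apply_symm_apply]
    simp only [hesymm] at hxy ⊢
    by_cases hC : C = C2
    · subst hC
      rw [Matrix.blockDiagonal'_apply_eq, ha C x y (fun h => hxy (congrArg _ h))]
      rw [SimpleGraph.comap_adj, SimpleGraph.deleteEdges_adj]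
      refine ⟨fun h => ⟨h, fun hxT => ?_⟩, fun h => h.1⟩
      have hb := hT _ hxT
      rw [SimpleGraph.isBridge_iff] at hb
      apply hb
      have hre : (G.deleteEdges T).Reachable x.1 y.1 :=
        SimpleGraph.ConnectedComponent.exact (x.2.trans y.2.symm)
      exact hre.mono (SimpleGraph.deleteEdges_anti (Set.singleton_subset_iff.mpr hxT))
    · rw [Matrix.blockDiagonal'_apply_ne _ _ _ hC]
      refine ⟨fun h => absurd rfl h, fun h => absurd ?_ hC⟩
      exact x.2.symm.trans ((SimpleGraph.ConnectedComponent.sound h.reachable).trans y.2)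
  · rw [Matrix.submatrix_mul_equiv, ← Matrix.blockDiagonal'_mul]
    simp only [hAB]
    have := Matrix.blockDiagonal'_one (α := ℝ)
      (m' := fun C : (G.deleteEdges T).ConnectedComponent => C.supp)
    change ((Matrix.blockDiagonal' (1 : ∀ C : (G.deleteEdges T).ConnectedComponent,
      Matrix C.supp C.supp ℝ)).submatrix e e) = 1
    rw [this, Matrix.submatrix_one_equiv]
  · intro x
    rw [Matrix.submatrix_apply, he, Matrix.blockDiagonal'_apply_eq]
    exact hB _ _

/-- If `T` is a set of bridges of a connected graph `G` and the induced subgraph of `G`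
on the vertex set of every connected component of `G - T` has property (P), then `G`
has property (P). -/
theorem stmt_9 {V : Type*} [Finite V] (G : SimpleGraph V) (hconn : G.Connected)
    (T : Set (Sym2 V)) (hT : ∀ e ∈ T, G.IsBridge e)
    (hcomp : ∀ C : (G.deleteEdges T).ConnectedComponent,
      HasPropertyP (G.induce C.supp)) :
    HasPropertyP G := by
  have key : HasPropertyP (G.deleteEdges (T \ T)) := by
    refine Set.Finite.induction_on_subset
      (motive := fun S _ => HasPropertyP (G.deleteEdges (T \ S))) T T.toFinite ?_ ?_
    · rw [Set.sdiff_empty]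
      exact base_case G T hT hcomp
    · intro e S heT hST heS ih
      induction e using Sym2.ind with
      | h u v =>
      by_cases hadj : G.Adj u v
      · refine add_bridge _ _ u v ?_ ?_ ih
        · intro hre
          refine (SimpleGraph.isBridge_iff.mp (hT _ heT)) (hre.mono ?_)
          exact SimpleGraph.deleteEdges_anti (Set.singleton_subset_iff.mpr ⟨heT, heS⟩)
        · intro x y
          have hxy : (x = u ∧ y = v) ∨ (x = v ∧ y = u) ↔ s(x, y) = s(u, v) := by
            rw [Sym2.eq_iff]
          have hG : s(x, y) = s(u, v) → G.Adj x y := by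
            intro h
            rw [← SimpleGraph.mem_edgeSet, h]
            exact hadj
          rw [hxy]
          simp only [SimpleGraph.deleteEdges_adj, Set.mem_sdiff, Set.mem_insert_iff]
          tauto
      · have : G.deleteEdges (T \ insert s(u, v) S) = G.deleteEdges (T \ S) := by
          ext x y
          have hG : s(x, y) = s(u, v) → ¬ G.Adj x y := by
            intro h
            rw [← SimpleGraph.mem_edgeSet, h]
            exact hadj
          simp only [SimpleGraph.deleteEdges_adj, Set.mem_sdiff, Set.mem_insert_iff]
          tauto
        rw [this]
        exact ih
  rw [Set.sdiff_self, SimpleGraph.deleteEdges_empty] at key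
  exact key
end

section
/- Let G be a finite simple graph containing three distinct edges e₁ = {v₁, u}, e₂ = {u, w}, e₃ = {v₂, w} with u ≠ w. Suppose the graph obtained from G by deleting e₁, e₂, e₃ has exactly three connected components: G₁ containing both v₁ and v₂, G₂ containing u, and G₃ containing w. If the induced subgraphs of G on the vertex sets of G₁, G₂ and G₃ each have property (P), then G has property (P). -/
open Matrix SimpleGraph

lemma det_minor_eq_adjugate {V : Type*} [Fintype V] [DecidableEq V] (A : Matrix V V ℝ) (v : V) :
    (A.submatrix (fun x : {x : V // x ≠ v} => (x : V))
        (fun x : {x : V // x ≠ v} => (x : V))).det = A.adjugate v v := by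
  rw [Matrix.adjugate_apply, Matrix.twoBlockTriangular_det _ (fun x => x ≠ v)]
  · have h1 : ((A.updateRow v (Pi.single v 1)).toSquareBlockProp (fun x => ¬ (x ≠ v))).det = 1 := by
      have : (A.updateRow v (Pi.single v 1)).toSquareBlockProp (fun x => ¬ (x ≠ v)) = 1 := by
        ext ⟨i, hi⟩ ⟨j, hj⟩
        have hi' : i = v := not_not.mp hi
        have hj' : j = v := not_not.mp hj
        subst hi'
        subst hj'
        simp [Matrix.toSquareBlockProp]
      rw [this, Matrix.det_one]
    rw [h1, mul_one]
    congr 1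
    ext ⟨i, hi⟩ ⟨j, hj⟩
    simp [Matrix.toSquareBlockProp, Matrix.updateRow_ne hi]
  · intro i hi j hj
    have hi' : i = v := not_not.mp hi
    subst hi'
    simp [Pi.single_eq_of_ne hj]

lemma hasPropertyP_iff {V : Type*} [Fintype V] [DecidableEq V] (G : SimpleGraph V) :
    HasPropertyP G ↔ ∃ A B : Matrix V V ℝ, A.IsSymm ∧ B.IsSymm ∧
      (∀ u v : V, u ≠ v → (A u v ≠ 0 ↔ G.Adj u v)) ∧ A * B = 1 ∧ ∀ v, B v v = 0 := by
  unfold HasPropertyP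
  rw [Subsingleton.elim (Fintype.ofFinite V) ‹_›, Subsingleton.elim (Classical.decEq V) ‹_›]
  simp only [det_minor_eq_adjugate]
  constructor
  · rintro ⟨A, hA, hs, hd, hv⟩
    refine ⟨A, A⁻¹, hA, ?_, hs, Matrix.mul_nonsing_inv _ (isUnit_iff_ne_zero.mpr hd), ?_⟩
    · rw [Matrix.IsSymm, Matrix.transpose_nonsing_inv, hA.eq]
    · intro v
      simp [Matrix.inv_def, hv]
  · rintro ⟨A, B, hA, hB, hs, hAB, hv⟩
    have hd : A.det ≠ 0 := by
      intro h
      have := congrArg Matrix.det hAB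
      simp [h] at this
    refine ⟨A, hA, hs, hd, fun v => ?_⟩
    have h2 : A.adjugate = A.det • B := by
      calc A.adjugate = A.adjugate * (A * B) := by rw [hAB, mul_one]
        _ = _ := by rw [← mul_assoc, Matrix.adjugate_mul]; simp
    simp [h2, hv]

lemma extend_component {V : Type*} [Fintype V] [DecidableEq V] (G : SimpleGraph V) (S : Set V)
    (h : HasPropertyP (G.induce S)) : ∃ A B : Matrix V V ℝ,
      (∀ x y, A x y = A y x) ∧ (∀ x y, B x y = B y x) ∧
      (∀ x y, x ∈ S → y ∈ S → x ≠ y → (A x y ≠ 0 ↔ G.Adj x y)) ∧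
      (∀ x y, y ∉ S → A x y = 0) ∧
      (∀ x y, x ∈ S → y ∈ S → ∑ z, A x z * B z y = if x = y then 1 else 0) ∧
      ∀ v, B v v = 0 := by
  classical
  obtain ⟨A, B, hA, hB, hs, hAB, hv⟩ := (hasPropertyP_iff _).mp h
  refine ⟨fun x y => if h : x ∈ S ∧ y ∈ S then A ⟨x, h.1⟩ ⟨y, h.2⟩ else 0,
    fun x y => if h : x ∈ S ∧ y ∈ S then B ⟨x, h.1⟩ ⟨y, h.2⟩ else 0, ?_, ?_, ?_, ?_, ?_, ?_⟩
  · intro x y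
    by_cases hx : x ∈ S <;> by_cases hy : y ∈ S <;> simp [hx, hy]
    exact hA.apply _ _
  · intro x y
    by_cases hx : x ∈ S <;> by_cases hy : y ∈ S <;> simp [hx, hy]
    exact hB.apply _ _
  · intro x y hx hy hxy
    have := hs ⟨x, hx⟩ ⟨y, hy⟩ (by simpa using hxy)
    simpa [hx, hy] using this
  · intro x y hy
    simp [hy]
  · intro x y hx hy
    have := congrFun (congrFun hAB ⟨x, hx⟩) ⟨y, hy⟩
    rw [Matrix.mul_apply, Matrix.one_apply] at this
    simp only [Subtype.mk.injEq] at this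
    rw [← this]
    rw [← Finset.sum_subset (Finset.subset_univ (Finset.univ.filter (· ∈ S))) (by
      intro z _ hz
      have hz' : z ∉ S := by simpa using hz
      simp [hz']), Finset.sum_subtype (p := fun z => z ∈ S) _ (by simp)]
    refine Finset.sum_congr rfl fun z _ => ?_
    simp [hx, hy]
  · intro v
    by_cases hx : v ∈ S <;> simp [hx, hv]

lemma main_aux {V : Type*} [Fintype V] [DecidableEq V] (D B : Matrix V V ℝ) (v₁ v₂ u w : V)
    (hBs : ∀ x y, B x y = B y x) (hDB : D * B = 1) (hd : ∀ v, B v v = 0)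
    (h1 : B v₁ u = 0) (h2 : B v₁ w = 0) (h3 : B u w = 0) (h4 : B v₂ u = 0) (h5 : B v₂ w = 0)
    (E T : Matrix V V ℝ)
    (hE : E = single v₁ u 1 + single u v₁ 1 + single u w 1 + single w u 1 + single v₂ w 1
      + single w v₂ 1)
    (hT : T = E - (B v₁ v₂) • (single u w 1 + single w u 1)) :
    (D + E) * (B - B * T * B) = 1 := by
  have key : E * B * T = E - T := by
    rw [hT, hE]
    simp only [Matrix.add_mul, Matrix.mul_add, Matrix.mul_sub, Matrix.mul_smul, smul_add,
      Matrix.single_mul_mul_single, hd, h1, h2, h3, h4, h5, hBs u, hBs w, hBs v₂ v₁]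
    simp
    exact add_comm _ _
  have h : (D + E) * (B - B * T * B) = D * B + (E - (D * B) * T - E * B * T) * B := by
    noncomm_ring
  rw [h, key, hDB]
  simp

/-- Suppose `G` contains three distinct edges `e₁ = {v₁,u}`, `e₂ = {u,w}`, `e₃ = {v₂,w}`
(with `u ≠ w`), and deleting them leaves exactly three connected components: one
containing both `v₁` and `v₂`, one containing `u`, and one containing `w`.  If the
induced subgraphs on these three components all have property (P), then so does `G`. -/
theorem stmt_10 {V : Type*} [Finite V] (G : SimpleGraph V) (v₁ v₂ u w : V)
    (huw : u ≠ w)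
    (he₁ : G.Adj v₁ u) (he₂ : G.Adj u w) (he₃ : G.Adj v₂ w)
    (hne₁₂ : s(v₁, u) ≠ s(u, w)) (hne₂₃ : s(u, w) ≠ s(v₂, w))
    (hne₁₃ : s(v₁, u) ≠ s(v₂, w))
    (hv₁₂ : (G.deleteEdges {s(v₁, u), s(u, w), s(v₂, w)}).connectedComponentMk v₁ =
      (G.deleteEdges {s(v₁, u), s(u, w), s(v₂, w)}).connectedComponentMk v₂)
    (h₁₂ : (G.deleteEdges {s(v₁, u), s(u, w), s(v₂, w)}).connectedComponentMk v₁ ≠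
      (G.deleteEdges {s(v₁, u), s(u, w), s(v₂, w)}).connectedComponentMk u)
    (h₁₃ : (G.deleteEdges {s(v₁, u), s(u, w), s(v₂, w)}).connectedComponentMk v₁ ≠
      (G.deleteEdges {s(v₁, u), s(u, w), s(v₂, w)}).connectedComponentMk w)
    (h₂₃ : (G.deleteEdges {s(v₁, u), s(u, w), s(v₂, w)}).connectedComponentMk u ≠
      (G.deleteEdges {s(v₁, u), s(u, w), s(v₂, w)}).connectedComponentMk w)
    (hall : ∀ C : (G.deleteEdges {s(v₁, u), s(u, w), s(v₂, w)}).ConnectedComponent,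
      C = (G.deleteEdges {s(v₁, u), s(u, w), s(v₂, w)}).connectedComponentMk v₁ ∨
      C = (G.deleteEdges {s(v₁, u), s(u, w), s(v₂, w)}).connectedComponentMk u ∨
      C = (G.deleteEdges {s(v₁, u), s(u, w), s(v₂, w)}).connectedComponentMk w)
    (hP₁ : HasPropertyP (G.induce
      ((G.deleteEdges {s(v₁, u), s(u, w), s(v₂, w)}).connectedComponentMk v₁).supp))
    (hP₂ : HasPropertyP (G.induce
      ((G.deleteEdges {s(v₁, u), s(u, w), s(v₂, w)}).connectedComponentMk u).supp))
    (hP₃ : HasPropertyP (G.induce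
      ((G.deleteEdges {s(v₁, u), s(u, w), s(v₂, w)}).connectedComponentMk w).supp)) :
    HasPropertyP G := by
  classical
  have : Fintype V := Fintype.ofFinite V
  set H := G.deleteEdges {s(v₁, u), s(u, w), s(v₂, w)} with hH
  have hex : ∀ C : H.ConnectedComponent, HasPropertyP (G.induce C.supp) := by
    intro C
    rcases hall C with rfl | rfl | rfl
    · exact hP₁
    · exact hP₂
    · exact hP₃
  choose A B hA hB hs hz hAB hv using fun C : H.ConnectedComponent =>
    extend_component G C.supp (hex C)
  set c := H.connectedComponentMk with hc
  simp only [ConnectedComponent.mem_supp_iff] at hs hz hAB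
  let D : Matrix V V ℝ := fun x y => if c x = c y then A (c x) x y else 0
  let Bt : Matrix V V ℝ := fun x y => if c x = c y then B (c x) x y else 0
  have hDs : ∀ x y, D x y = D y x := by
    intro x y
    by_cases h : c x = c y
    · simp only [D, h, if_true]; exact hA _ _ _
    · simp only [D, h, Ne.symm h, if_false]
  have hBs : ∀ x y, Bt x y = Bt y x := by
    intro x y
    by_cases h : c x = c y
    · simp only [Bt, h, if_true]; exact hB _ _ _
    · simp only [Bt, h, Ne.symm h, if_false]
  have hB0 : ∀ x y, c x ≠ c y → Bt x y = 0 := by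
    intro x y h
    simp only [Bt, h, if_false]
  have hBd : ∀ v, Bt v v = 0 := by
    intro v
    simp only [Bt, if_true, hv]
  have hDB : D * Bt = 1 := by
    ext x y
    rw [Matrix.mul_apply, Matrix.one_apply]
    by_cases h : c x = c y
    · rw [← hAB (c x) x y rfl h.symm]
      refine Finset.sum_congr rfl fun z _ => ?_
      by_cases hzx : c x = c z
      · have : c z = c y := hzx.symm.trans h
        simp only [D, Bt, hzx, this, if_true]
      · rw [hz (c x) x z (Ne.symm hzx)]
        simp only [D, hzx, if_false, zero_mul]
    · rw [if_neg (fun e => h (by rw [e]))]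
      refine Finset.sum_eq_zero fun z _ => ?_
      by_cases hzx : c x = c z
      · have : c z ≠ c y := fun e => h (hzx.trans e)
        simp only [Bt, this, if_false, mul_zero]
      · simp only [D, hzx, if_false, zero_mul]
  have h42 : c v₂ ≠ c u := fun e => h₁₂ (hv₁₂.trans e)
  have h43 : c v₂ ≠ c w := fun e => h₁₃ (hv₁₂.trans e)
  obtain ⟨E, hE⟩ : ∃ E : Matrix V V ℝ, E = single v₁ u 1 + single u v₁ 1 + single u w 1
    + single w u 1 + single v₂ w 1 + single w v₂ 1 := ⟨_, rfl⟩
  obtain ⟨T, hT⟩ : ∃ T : Matrix V V ℝ, T = E - (Bt v₁ v₂) • (single u w 1 + single w u 1) :=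
    ⟨_, rfl⟩
  have hM := main_aux D Bt v₁ v₂ u w hBs hDB hBd (hB0 _ _ h₁₂) (hB0 _ _ h₁₃) (hB0 _ _ h₂₃)
    (hB0 _ _ h42) (hB0 _ _ h43) E T hE hT
  have hDS : D.IsSymm := by ext x y; exact hDs y x
  have hBS : Bt.IsSymm := by ext x y; exact hBs y x
  have hES : E.IsSymm := by
    rw [Matrix.IsSymm, hE]
    simp only [Matrix.transpose_add, Matrix.transpose_single]
    abel
  have hTS : T.IsSymm := by
    rw [Matrix.IsSymm, hT]
    simp only [Matrix.transpose_sub, Matrix.transpose_smul, Matrix.transpose_add,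
      Matrix.transpose_single, hES.eq]
    rw [add_comm (single w u (1:ℝ))]
  refine (hasPropertyP_iff G).mpr ⟨D + E, Bt - Bt * T * Bt, hDS.add hES, ?_, ?_, hM, ?_⟩
  · rw [Matrix.IsSymm]
    simp only [Matrix.transpose_sub, Matrix.transpose_mul, hBS.eq, hTS.eq, mul_assoc]
  · intro x y hxy
    by_cases h : c x = c y
    · have hE0 : E x y = 0 := by
        rw [hE]
        simp only [Matrix.add_apply, Matrix.single_apply]
        have g : ∀ p q, c p ≠ c q → ¬ (p = x ∧ q = y) := by
          rintro p q hpq ⟨rfl, rfl⟩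
          exact hpq h
        rw [if_neg (g _ _ h₁₂), if_neg (g _ _ h₁₂.symm), if_neg (g _ _ h₂₃),
          if_neg (g _ _ h₂₃.symm), if_neg (g _ _ h43), if_neg (g _ _ h43.symm)]
        simp
      rw [Matrix.add_apply, hE0, add_zero, ← hs (c x) x y rfl h.symm hxy]
      simp only [D, h, if_true]
    · have hD0 : D x y = 0 := by simp only [D, h, if_false]
      rw [Matrix.add_apply, hD0, zero_add]
      have hEdge : E x y ≠ 0 ↔ s(x, y) ∈ ({s(v₁, u), s(u, w), s(v₂, w)} : Set (Sym2 V)) := by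
        have hn : ∀ p : Prop, [Decidable p] → (0:ℝ) ≤ if p then 1 else 0 := by
          intro p _; split_ifs <;> norm_num
        rw [hE]
        simp only [Matrix.add_apply, Matrix.single_apply, Set.mem_insert_iff,
          Set.mem_singleton_iff, Sym2.eq_iff]
        constructor
        · intro hh
          by_contra hcon
          apply hh
          push Not at hcon
          rw [if_neg, if_neg, if_neg, if_neg, if_neg, if_neg]
          · simp
          all_goals grind
        · intro hh
          apply ne_of_gt
          have a1 := hn (v₁ = x ∧ u = y)
          have a2 := hn (u = x ∧ v₁ = y)
          have a3 := hn (u = x ∧ w = y)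
          have a4 := hn (w = x ∧ u = y)
          have a5 := hn (v₂ = x ∧ w = y)
          have a6 := hn (w = x ∧ v₂ = y)
          rcases hh with (⟨hx, hy⟩ | ⟨hx, hy⟩) | (⟨hx, hy⟩ | ⟨hx, hy⟩) | (⟨hx, hy⟩ | ⟨hx, hy⟩)
          · rw [if_pos (⟨hx.symm, hy.symm⟩ : v₁ = x ∧ u = y)]; linarith
          · rw [if_pos (⟨hx.symm, hy.symm⟩ : u = x ∧ v₁ = y)]; linarith
          · rw [if_pos (⟨hx.symm, hy.symm⟩ : u = x ∧ w = y)]; linarith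
          · rw [if_pos (⟨hx.symm, hy.symm⟩ : w = x ∧ u = y)]; linarith
          · rw [if_pos (⟨hx.symm, hy.symm⟩ : v₂ = x ∧ w = y)]; linarith
          · rw [if_pos (⟨hx.symm, hy.symm⟩ : w = x ∧ v₂ = y)]; linarith
      rw [hEdge]
      constructor
      · intro hm
        rw [← SimpleGraph.mem_edgeSet]
        rcases hm with e | e | e
        · rw [e]; exact he₁
        · rw [e]; exact he₂
        · rw [e]; exact he₃
      · intro ha
        by_contra hm
        apply h
        have hadj : H.Adj x y := by
          rw [hH, SimpleGraph.deleteEdges_adj]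
          exact ⟨ha, hm⟩
        exact ConnectedComponent.sound hadj.reachable
  · intro x
    have hz2 : ∀ p q, c p ≠ c q → Bt x p * Bt q x = 0 := by
      intro p q hpq
      by_cases h : c x = c p
      · rw [hB0 q x (fun e => hpq (h.symm.trans e.symm)), mul_zero]
      · rw [hB0 x p h, zero_mul]
    have hsing : ∀ p q, c p ≠ c q → (Bt * single p q (1:ℝ) * Bt) x x = 0 := by
      intro p q hpq
      rw [Matrix.mul_assoc, Matrix.mul_apply, Finset.sum_eq_single p]
      · simpa using hz2 p q hpq
      · intro b _ hb
        simp [hb]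
      · simp
    rw [Matrix.sub_apply, hBd, hT, hE]
    simp only [Matrix.mul_add, Matrix.add_mul, Matrix.mul_sub, Matrix.sub_mul, Matrix.mul_smul,
      Matrix.smul_mul, Matrix.add_apply, Matrix.sub_apply, Matrix.smul_apply]
    rw [hsing _ _ h₁₂, hsing _ _ h₁₂.symm, hsing _ _ h₂₃,
          hsing _ _ h₂₃.symm, hsing _ _ h43, hsing _ _ h43.symm]
    simp
end
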